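/- Let ψ, ζ : [0,∞) → ℝ be continuous functions and suppose there exist Q > 0 and η > 0 such that |ψ(t)| ≤ Q·exp(t/η) and |ζ(t)| ≤ Q·exp(t/η) for all t ≥ 0. Define the convolution (ψ ∗ ζ)(t) = ∫₀^t ψ(t−x)·ζ(x) dx. Then there exists η' > 0 such that for every u with 0 < u < η', the Sumudu transform satisfies S[ψ ∗ ζ](u) = u · S[ψ](u) · S[ζ](u). -/

import Mathlib

open MeasureTheory Real Set

/-- The Sumudu transform of `f : [0,∞) → ℝ`: `S[f](u) = ∫₀^∞ f(t·u)·e^{−t} dt`. -/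
noncomputable def sumudu (f : ℝ → ℝ) (u : ℝ) : ℝ :=
  ∫ t in Set.Ioi (0 : ℝ), f (t * u) * Real.exp (-t)

lemma sumudu_integrable (ψ : ℝ → ℝ) (Q η u : ℝ) (hη : 0 < η)
    (hψc : ContinuousOn ψ (Set.Ici 0))
    (hψb : ∀ t ≥ (0 : ℝ), |ψ t| ≤ Q * Real.exp (t / η)) (hu : 0 < u) (huη : u < η) :
    IntegrableOn (fun t => ψ (t * u) * Real.exp (-t)) (Set.Ioi 0) := by
  have hb : 0 < 1 - u / η := by
    have : u / η < 1 := (div_lt_one hη).2 huη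
    linarith
  have h1 : IntegrableOn (fun t => Q * Real.exp (-(1 - u / η) * t)) (Set.Ioi 0) :=
    (exp_neg_integrableOn_Ioi 0 hb).const_mul Q
  refine Integrable.mono' h1 ?_ ?_
  · refine ContinuousOn.aestronglyMeasurable ?_ measurableSet_Ioi
    refine ContinuousOn.mul ?_ (by fun_prop)
    refine hψc.comp (by fun_prop) ?_
    intro t ht
    exact (mul_pos ht hu).le
  · filter_upwards [ae_restrict_mem measurableSet_Ioi] with t ht
    have h2 := hψb (t * u) (mul_pos ht hu).le
    rw [Real.norm_eq_abs, abs_mul, abs_of_pos (Real.exp_pos _)]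
    calc |ψ (t * u)| * Real.exp (-t) ≤ Q * Real.exp (t * u / η) * Real.exp (-t) := by gcongr
      _ = Q * Real.exp (-(1 - u / η) * t) := by
        rw [mul_assoc, ← Real.exp_add]
        congr 2
        ring

theorem sumudu_convolution (ψ ζ : ℝ → ℝ) (Q η : ℝ) (hQ : 0 < Q) (hη : 0 < η)
    (hψc : ContinuousOn ψ (Set.Ici 0)) (hζc : ContinuousOn ζ (Set.Ici 0))
    (hψb : ∀ t ≥ (0 : ℝ), |ψ t| ≤ Q * Real.exp (t / η))
    (hζb : ∀ t ≥ (0 : ℝ), |ζ t| ≤ Q * Real.exp (t / η)) :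
    ∃ η' > (0 : ℝ), ∀ u : ℝ, 0 < u → u < η' →
      sumudu (fun t => ∫ x in (0 : ℝ)..t, ψ (t - x) * ζ x) u =
        u * sumudu ψ u * sumudu ζ u := by
  refine ⟨η, hη, fun u hu huη => ?_⟩
  have key := integral_posConvolution (μ := volume) (ν := volume)
    (sumudu_integrable ζ Q η u hη hζc hζb hu huη)
    (sumudu_integrable ψ Q η u hη hψc hψb hu huη) (ContinuousLinearMap.mul ℝ ℝ)
  simp only [ContinuousLinearMap.mul_apply'] at key
  unfold sumudu
  rw [mul_assoc, mul_comm (∫ t in Set.Ioi (0 : ℝ), ψ (t * u) * Real.exp (-t)), ← key,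
    ← integral_const_mul]
  congr 1
  ext x
  have h := intervalIntegral.mul_integral_comp_mul_right (a := 0) (b := x)
    (f := fun y => ψ (x * u - y) * ζ y) (c := u)
  rw [zero_mul] at h
  beta_reduce
  rw [← h, mul_assoc, ← intervalIntegral.integral_mul_const]
  congr 2
  ext t
  have he : Real.exp (-x) = Real.exp (-t) * Real.exp (-(x - t)) := by
    rw [← Real.exp_add]
    congr 1
    ring
  rw [he, sub_mul]
  ring
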